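/- The exterior differentiation operator is the unique operator satisfying the Cartan magic formula: if D = (D_q : Λ^q(L) → Λ^{q+1}(L))_{q≥0} is any family of maps such that i_z ∘ D_q + D_{q−1} ∘ i_z = L_z on Λ^q(L) for every z ∈ L and every q ≥ 0 (with the convention that i_z vanishes on Λ^0(L) = A), then D_q ω = dω for every q and every ω ∈ Λ^q(L). -/

import Mathlib

open scoped BigOperators

/-- A Lie–Rinehart algebra structure on `L`: `L` is an `A`-module and a Lie ring, with an
`A`-linear anchor `ρ` into the `R`-derivations of `A` that is a Lie ring morphism, satisfying
the Leibniz rule `⁅x, a • y⁆ = a • ⁅x, y⁆ + (ρ x a) • y`. -/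
structure LieRinehartPkg (R A L : Type*) [CommRing R] [CommRing A] [Algebra R A]
    [LieRing L] [Module A L] where
  ρ : L →ₗ[A] Derivation R A A
  ρ_bracket : ∀ x y : L, ρ ⁅x, y⁆ = ⁅ρ x, ρ y⁆
  leibniz : ∀ (x y : L) (a : A), ⁅x, a • y⁆ = a • ⁅x, y⁆ + (ρ x) a • y

/-- `ω : L^q → A` is a differential `q`-form: `A`-multilinear and alternating. -/
def IsForm {A L : Type*} [CommRing A] [LieRing L] [Module A L] {q : ℕ}
    (ω : (Fin q → L) → A) : Prop :=
  (∀ (v : Fin q → L) (i : Fin q) (x y : L),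
      ω (Function.update v i (x + y)) = ω (Function.update v i x) + ω (Function.update v i y)) ∧
  (∀ (v : Fin q → L) (i : Fin q) (a : A) (x : L),
      ω (Function.update v i (a • x)) = a * ω (Function.update v i x)) ∧
  (∀ (v : Fin q → L) (i j : Fin q), i ≠ j → v i = v j → ω v = 0)

/-- A `(q, r)`-shuffle: a permutation strictly increasing on the first `q` and on the
last `r` positions. -/
def IsShuffle (q r : ℕ) (σ : Equiv.Perm (Fin (q + r))) : Prop :=
  (∀ i j : Fin (q + r), i < j → (j : ℕ) < q → σ i < σ j) ∧
  (∀ i j : Fin (q + r), i < j → q ≤ (i : ℕ) → σ i < σ j)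

instance (q r : ℕ) (σ : Equiv.Perm (Fin (q + r))) : Decidable (IsShuffle q r σ) := by
  unfold IsShuffle; infer_instance

/-- Exterior (shuffle) product of a `q`-form and an `r`-form:
`(ω ∧ θ)(z₁,…,z_{q+r}) = Σ_σ sgn σ • ω(z_{σ(1)},…,z_{σ(q)}) · θ(z_{σ(q+1)},…,z_{σ(q+r)})`,
summing over `(q,r)`-shuffles. -/
noncomputable def wedge {A L : Type*} [CommRing A] [LieRing L] [Module A L] {q r : ℕ}
    (ω : (Fin q → L) → A) (θ : (Fin r → L) → A) : (Fin (q + r) → L) → A :=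
  fun z => ∑ σ : Equiv.Perm (Fin (q + r)),
    if IsShuffle q r σ then
      ((Equiv.Perm.sign σ : ℤ) •
        (ω (fun i => z (σ (Fin.castAdd r i))) * θ (fun j => z (σ (Fin.natAdd q j)))))
    else 0

/-- Covariant Lie derivative of a `q`-form with respect to `z`. -/
def lieDer {R A L : Type*} [CommRing R] [CommRing A] [Algebra R A] [LieRing L] [Module A L]
    (P : LieRinehartPkg R A L) (z : L) {q : ℕ} (ω : (Fin q → L) → A) :
    (Fin q → L) → A :=
  fun v => P.ρ z (ω v) - ∑ i : Fin q, ω (Function.update v i ⁅z, v i⁆)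

/-- Interior product: `(i_z ω)(z₂,…,z_q) = ω(z, z₂, …, z_q)`, and `i_z f = 0` on `Λ⁰`. -/
def iProd {A L : Type*} [CommRing A] [LieRing L] [Module A L] (z : L) :
    {q : ℕ} → ((Fin q → L) → A) → (Fin (q - 1) → L) → A
  | 0, _ => fun _ => 0
  | _ + 1, ω => fun v => ω (Fin.cons z v)

/-- The argument list `(⁅v i, v j⁆, v 0, …, v̂ i, …, v̂ j, …, v q)` (meaningful for `i < j`). -/
def insOmit2 {L : Type*} [LieRing L] {q : ℕ} (v : Fin (q + 1) → L) (i j : Fin (q + 1)) :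
    Fin q → L := fun k =>
  if (k : ℕ) = 0 then ⁅v i, v j⁆
  else if (k : ℕ) - 1 < (i : ℕ) then v ⟨(k : ℕ) - 1, by have := k.isLt; omega⟩
  else if (k : ℕ) < (j : ℕ) then v ⟨(k : ℕ), by have := k.isLt; omega⟩
  else v ⟨(k : ℕ) + 1, by have := k.isLt; omega⟩

/-- Exterior differential:
`(dω)(z₀,…,z_q) = Σᵢ (−1)ⁱ ρ(zᵢ)(ω(…,ẑᵢ,…)) + Σ_{i<j} (−1)^{i+j} ω(⁅zᵢ,zⱼ⁆, …, ẑᵢ, …, ẑⱼ, …)`. -/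
def extDer {R A L : Type*} [CommRing R] [CommRing A] [Algebra R A] [LieRing L] [Module A L]
    (P : LieRinehartPkg R A L) {q : ℕ} (ω : (Fin q → L) → A) :
    (Fin (q + 1) → L) → A := fun v =>
  (∑ i : Fin (q + 1), (-1 : A) ^ (i : ℕ) * P.ρ (v i) (ω (fun k => v (i.succAbove k))))
    + ∑ i : Fin (q + 1), ∑ j : Fin (q + 1),
        if i < j then (-1 : A) ^ ((i : ℕ) + (j : ℕ)) * ω (insOmit2 v i j) else 0

/-- Pullback of forms along an `A`-linear map. -/
def pullback {A L L' : Type*} [CommRing A] [LieRing L] [LieRing L'] [Module A L] [Module A L']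
    (Φ : L →ₗ[A] L') {q : ℕ} (ω : (Fin q → L') → A) : (Fin q → L) → A :=
  fun v => ω (fun i => Φ (v i))

/-- A linear `ρ`-connection on `L`: `A`-linear in the first slot, additive in the second,
with the Leibniz rule `D x (a • u) = a • D x u + (ρ x a) • u`. -/
structure LinearConnection {R A L : Type*} [CommRing R] [CommRing A] [Algebra R A]
    [LieRing L] [Module A L] (P : LieRinehartPkg R A L) where
  D : L → L → L
  add_left : ∀ x y u : L, D (x + y) u = D x u + D y u
  smul_left : ∀ (a : A) (x u : L), D (a • x) u = a • D x u
  add_right : ∀ x u v : L, D x (u + v) = D x u + D x v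
  leibniz : ∀ (x : L) (a : A) (u : L), D x (a • u) = a • D x u + (P.ρ x) a • u

/-- A form as a bundled alternating map. -/
def IsForm.toAlt {A L : Type*} [CommRing A] [LieRing L] [Module A L] {q : ℕ}
    {ω : (Fin q → L) → A} (h : IsForm ω) : L [⋀^Fin q]→ₗ[A] A where
  toFun := ω
  map_update_add' := by
    intro d v i x y
    rw [Subsingleton.elim d (instDecidableEqFin q)]
    exact h.1 v i x y
  map_update_smul' := by
    intro d v i a x
    rw [Subsingleton.elim d (instDecidableEqFin q)]
    exact h.2.1 v i a x
  map_eq_zero_of_eq' := by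
    intro v i j hv hij
    exact h.2.2 v i j hij hv

theorem IsForm.swap {A L : Type*} [CommRing A] [LieRing L] [Module A L] {q : ℕ}
    {ω : (Fin q → L) → A} (h : IsForm ω) (v : Fin q → L) (i j : Fin q) (hij : i ≠ j) :
    ω (v ∘ Equiv.swap i j) = - ω v :=
  h.toAlt.map_swap v hij

theorem IsForm.cons_succAbove {A L : Type*} [CommRing A] [LieRing L] [Module A L] {q : ℕ}
    {ω : (Fin (q + 1) → L) → A} (h : IsForm ω) (v : Fin (q + 1) → L) (j : Fin (q + 1)) (x : L) :
    (-1 : A) ^ (j : ℕ) * ω (Fin.cons x (fun k => v (j.succAbove k)))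
      = ω (Function.update v j x) := by
  have h1 : (Fin.cons x (fun k => v (j.succAbove k)) : Fin (q + 1) → L)
      = Function.update v j x ∘ (j.cycleRange).symm := by
    funext k
    refine Fin.cases ?_ (fun k => ?_) k
    · simp
    · simp [Fin.succAbove_ne]
  have h2 : ω (Function.update v j x ∘ (j.cycleRange).symm)
      = Equiv.Perm.sign (j.cycleRange).symm • ω (Function.update v j x) :=
    h.toAlt.map_perm _ _
  rw [h1, h2]
  simp [Units.smul_def, ← mul_assoc, ← mul_pow]

theorem IsForm.iProd {A L : Type*} [CommRing A] [LieRing L] [Module A L] {q : ℕ}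
    {ω : (Fin (q + 1) → L) → A} (h : IsForm ω) (z : L) :
    IsForm (q := q) (fun v => ω (Fin.cons z v)) := by
  refine ⟨?_, ?_, ?_⟩
  · intro v i x y
    simp only [Fin.cons_update]
    exact h.1 _ _ _ _
  · intro v i a x
    simp only [Fin.cons_update]
    exact h.2.1 _ _ _ _
  · intro v i j hij hv
    exact h.2.2 _ i.succ j.succ (by simpa using hij) (by simpa using hv)

theorem insOmit2_zero_succ {L : Type*} [LieRing L] {q : ℕ} (z : L) (v : Fin (q + 1) → L)
    (j : Fin (q + 1)) :
    insOmit2 (Fin.cons z v : Fin (q + 2) → L) 0 j.succ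
      = Fin.cons ⁅z, v j⁆ (fun k => v (j.succAbove k)) := by
  funext k
  refine Fin.cases ?_ (fun k => ?_) k
  · simp [insOmit2]
  · have e1 : ∀ h, (⟨(k : ℕ) + 1, h⟩ : Fin (q + 2)) = (k.castSucc).succ := fun h => rfl
    have e2 : ∀ h, (⟨(k : ℕ) + 1 + 1, h⟩ : Fin (q + 2)) = (k.succ).succ := fun h => rfl
    simp only [insOmit2, Fin.val_succ, Fin.val_zero, e1, e2, Fin.cons_succ, Fin.succAbove,
      Fin.lt_def, Fin.val_castSucc]
    split_ifs <;> first | rfl | (exfalso; omega)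

theorem insOmit2_succ_succ {L : Type*} [LieRing L] {q : ℕ} (z : L) (v : Fin (q + 2) → L)
    (i j : Fin (q + 2)) (hij : i < j) :
    insOmit2 (Fin.cons z v : Fin (q + 3) → L) i.succ j.succ
      = (Fin.cons z (insOmit2 v i j) : Fin (q + 2) → L) ∘ Equiv.swap 0 1 := by
  funext k
  refine Fin.cases ?_ (fun k => ?_) k
  · have e : (1 : Fin (q + 2)) = Fin.succ 0 := rfl
    rw [Function.comp_apply, Equiv.swap_apply_left, e, Fin.cons_succ]
    simp [insOmit2]
  · refine Fin.cases ?_ (fun k => ?_) k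
    · simp [insOmit2]
    · have e0 : (Equiv.swap (0 : Fin (q + 2)) 1) k.succ.succ = k.succ.succ :=
        Equiv.swap_apply_of_ne_of_ne (Fin.succ_ne_zero _)
          (by intro h; have := congrArg Fin.val h; simp at this)
      have e1 : ∀ h, (⟨(k : ℕ) + 1, h⟩ : Fin (q + 3)) = (k.castSucc.castSucc).succ := fun h => rfl
      have e2 : ∀ h, (⟨(k : ℕ) + 1 + 1, h⟩ : Fin (q + 3)) = (k.succ.castSucc).succ := fun h => rfl
      have e3 : ∀ h, (⟨(k : ℕ) + 1 + 1 + 1, h⟩ : Fin (q + 3)) = (k.succ.succ).succ := fun h => rfl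
      simp only [Function.comp_apply, e0, Fin.cons_succ]
      simp only [insOmit2, Fin.val_succ, Nat.add_sub_cancel, e1, e2, e3, Fin.cons_succ]
      split_ifs <;> first | rfl | omega

/-- Cartan's magic formula for `extDer`. -/
theorem extDer_cartan {R A L : Type*} [CommRing R] [CommRing A] [Algebra R A]
    [LieRing L] [Module A L] (P : LieRinehartPkg R A L) {q : ℕ}
    (ω : (Fin (q + 1) → L) → A) (h : IsForm ω) (z : L) (v : Fin (q + 1) → L) :
    extDer P ω (Fin.cons z v) + extDer P (q := q) (fun w => ω (Fin.cons z w)) v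
      = lieDer P z ω v := by
  have hA : ∀ i : Fin (q + 1),
      (fun k => (Fin.cons z v : Fin (q + 2) → L) (i.succ.succAbove k))
        = Fin.cons z (fun k => v (i.succAbove k)) := by
    intro i
    funext k
    refine Fin.cases ?_ (fun k => ?_) k
    · simp
    · simp
  have hB : ∀ i j : Fin (q + 1), i < j →
      ω (insOmit2 (Fin.cons z v : Fin (q + 2) → L) i.succ j.succ)
        = - ω (Fin.cons z (insOmit2 v i j)) := by
    intro i j hij
    cases q with
    | zero => omega
    | succ q =>
      rw [insOmit2_succ_succ z v i j hij]
      exact h.swap _ 0 1 (by simp)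
  have hC : ∀ j : Fin (q + 1),
      (-1 : A) ^ (j : ℕ) * ω (insOmit2 (Fin.cons z v : Fin (q + 2) → L) 0 j.succ)
        = ω (Function.update v j ⁅z, v j⁆) := by
    intro j
    rw [insOmit2_zero_succ, ← h.cons_succAbove]
  have hD : ∀ i j : Fin (q + 1),
      (if i < j then (-1 : A) ^ ((i : ℕ) + 1 + ((j : ℕ) + 1)) *
          ω (insOmit2 (Fin.cons z v : Fin (q + 2) → L) i.succ j.succ) else 0)
        = - (if i < j then (-1 : A) ^ ((i : ℕ) + (j : ℕ)) *
          ω (Fin.cons z (insOmit2 v i j)) else 0) := by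
    intro i j
    split_ifs with hij
    · rw [hB i j hij]; ring
    · simp
  unfold extDer lieDer
  rw [Fin.sum_univ_succ, Fin.sum_univ_succ (n := q + 1)
    (f := fun i => ∑ j : Fin (q + 2), _)]
  simp only [Fin.sum_univ_succ (n := q + 1), Fin.cons_succ, Fin.cons_zero, hA, Fin.val_succ,
    Fin.val_zero, Fin.succ_lt_succ_iff, hD, Fin.succ_pos, if_true, lt_irrefl, if_false,
    Fin.not_lt_zero, zero_add, hC, Finset.sum_neg_distrib, Fin.zero_succAbove, pow_zero, one_mul,
    pow_succ, mul_neg, mul_one, neg_mul]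
  ring

/-- uniqueness of the exterior differentiation operator: any family
`D_q : Λ^q → Λ^{q+1}` satisfying `i_z ∘ D_q + D_{q−1} ∘ i_z = L_z` for all `z` and all `q`
(with `i_z = 0` on `Λ⁰`, so that for `q = 0` the condition reads `i_z ∘ D_0 = L_z`)
coincides with `d`. -/
theorem extDer_unique {R A L : Type*} [CommRing R] [CommRing A] [Algebra R A]
    [LieRing L] [Module A L] (P : LieRinehartPkg R A L)
    (D : ∀ q : ℕ, ((Fin q → L) → A) → ((Fin (q + 1) → L) → A))
    (h0 : ∀ (z : L) (f : (Fin 0 → L) → A) (v : Fin 0 → L),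
      iProd z (D 0 f) v = lieDer P z f v)
    (hsucc : ∀ (z : L) (q : ℕ) (ω : (Fin (q + 1) → L) → A), IsForm ω →
      ∀ v : Fin (q + 1) → L,
        iProd z (D (q + 1) ω) v + D q (iProd z ω) v = lieDer P z ω v)
    {q : ℕ} (ω : (Fin q → L) → A) (hω : IsForm ω) :
    D q ω = extDer P ω := by
  induction q with
  | zero =>
    funext v
    have h := h0 (v 0) ω (Fin.tail v)
    simp only [iProd, Fin.cons_self_tail] at h
    rw [h]
    simp [lieDer, extDer]
    rfl
  | succ q ih =>
    funext v
    have h := hsucc (v 0) q ω hω (Fin.tail v)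
    have h2 := extDer_cartan P ω hω (v 0) (Fin.tail v)
    have h3 := ih _ (hω.iProd (v 0))
    simp only [iProd, Fin.cons_self_tail] at h h2
    rw [← h2] at h
    erw [h3] at h
    exact add_right_cancel h
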